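/- Let z_0 ≤ z_1 ≤ ⋯ ≤ z_{n−1} be positive integers and let x be an integer with x > z_{n−1}. Then a_n(x; w) = Σ_{i=0}^{n} C(n,i) · a_{n−i}(x − z_i; w) · ( Σ_{π ∈ Π_i} w(0̂, π) · PF_π(Z) ), where for i = 0 the inner sum is interpreted as 1 (all integers being cast into R). (Lemma 3.6.) -/

import Mathlib

open Finset

variable {R : Type*} [CommRing R] [Algebra ℚ R]

/-- The zeta-type weight `w(0̂, π) = ∏_{B a block of π} w(|B|)`. -/
noncomputable def zetaWeight (w : ℕ → R) {n : ℕ} (π : Finpartition (univ : Finset (Fin n))) : R :=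
  ∏ B ∈ π.parts, w B.card

/-- The zeta-type enumerator `a_n(x; w)`. -/
noncomputable def aEnum (w : ℕ → R) (n : ℕ) (x : R) : R :=
  if n = 0 then 1 else
    ∑ π : Finpartition (univ : Finset (Fin n)), zetaWeight w π * x ^ π.parts.card

/-- `f : Fin n → ℕ` is a `z⃗`-parking function: all entries are positive, and for each
`i < n` at least `i + 1` of the entries are `≤ z i`. -/
def IsParking {n : ℕ} (z : ℕ → ℕ) (f : Fin n → ℕ) : Prop :=
  (∀ j, 1 ≤ f j) ∧
    ∀ i : Fin n, (i : ℕ) + 1 ≤ (univ.filter fun j => f j ≤ z (i : ℕ)).card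

/-- `PF_π(Z)`: the number of labelings of the blocks of `π` by positive integers whose
associated sequence (constant on each block) is a `z⃗`-parking function. -/
noncomputable def PFcount {n : ℕ} (π : Finpartition (univ : Finset (Fin n))) (z : ℕ → ℕ) : ℕ :=
  Nat.card { f : Fin n → ℕ //
    (∀ B ∈ π.parts, ∀ i ∈ B, ∀ j ∈ B, f i = f j) ∧ IsParking z f }

section LabelWeight

variable {A : Type*} [CommRing A]

/-- The labeling `f` is constant on each block of `π`. -/
def IsConstOnParts {n : ℕ} (π : Finpartition (univ : Finset (Fin n))) (f : Fin n → ℕ) : Prop :=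
  ∀ B ∈ π.parts, ∀ i ∈ B, ∀ j ∈ B, f i = f j

open Classical in
/-- The total weight of the partitions on whose blocks `f` is constant. -/
noncomputable def labelWeight (w : ℕ → A) {n : ℕ} (f : Fin n → ℕ) : A :=
  ∑ π : Finpartition (univ : Finset (Fin n)) with IsConstOnParts π f, zetaWeight w π

theorem aEnum_eq_sum (w : ℕ → A) (n : ℕ) (x : A) :
    aEnum w n x =
      ∑ π : Finpartition (univ : Finset (Fin n)), zetaWeight w π * x ^ π.parts.card := by
  rcases n with _ | n
  · have h : ∀ π : Finpartition (univ : Finset (Fin 0)), π.parts = ∅ := fun π =>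
      Finpartition.parts_eq_empty_iff.2 rfl
    have : Unique (Finpartition (univ : Finset (Fin 0))) :=
      inferInstanceAs (Unique (Finpartition (⊥ : Finset (Fin 0))))
    simp [aEnum, zetaWeight, h]
  · simp [aEnum]

open Classical in
theorem card_filter_isConstOnParts {n : ℕ} (π : Finpartition (univ : Finset (Fin n)))
    (t : Finset ℕ) :
    #{f ∈ Fintype.piFinset fun _ => t | IsConstOnParts π f} = #t ^ #π.parts := by
  have hpart : ∀ a, π.part a ∈ π.parts := fun a => π.part_mem.2 (mem_univ a)
  have : #(Fintype.piFinset fun _ : π.parts => t) = #t ^ #π.parts := by simp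
  rw [← this]
  symm
  refine Finset.card_bij (fun g _ a => g ⟨π.part a, hpart a⟩) ?_ ?_ ?_
  · intro g hg
    simp only [Fintype.mem_piFinset] at hg
    simp only [mem_filter, Fintype.mem_piFinset]
    refine ⟨fun a => hg _, fun B hB i hi j hj => ?_⟩
    simp only [π.part_eq_of_mem hB hi, π.part_eq_of_mem hB hj]
  · intro g _ g' _ h
    ext ⟨B, hB⟩
    obtain ⟨a, ha⟩ := π.nonempty_of_mem_parts hB
    simpa only [π.part_eq_of_mem hB ha] using congrFun h a
  · intro f hf
    simp only [mem_filter, Fintype.mem_piFinset] at hf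
    choose r hr using fun B : π.parts => π.nonempty_of_mem_parts B.2
    refine ⟨fun B => f (r B), by simp [hf.1], ?_⟩
    ext a
    exact hf.2 _ (hpart a) _ (hr ⟨_, hpart a⟩) _ (π.mem_part (mem_univ a))

theorem sum_labelWeight (w : ℕ → A) (n : ℕ) (t : Finset ℕ) :
    ∑ f ∈ Fintype.piFinset (fun _ : Fin n => t), labelWeight w f = aEnum w n (#t : A) := by
  classical
  simp only [aEnum_eq_sum, labelWeight, sum_filter]
  rw [sum_comm]
  refine sum_congr rfl fun π _ => ?_
  rw [← sum_filter, sum_const, card_filter_isConstOnParts, nsmul_eq_mul]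
  push_cast
  ring

theorem IsParking.le {n : ℕ} {z : ℕ → ℕ} {f : Fin n → ℕ} (h : IsParking z f) (j : Fin n) :
    f j ≤ z (n - 1) := by
  have hn : 0 < n := j.pos
  have h' := h.2 ⟨n - 1, by omega⟩
  have : (univ.filter fun j => f j ≤ z (n - 1)) = univ := by
    apply eq_univ_of_card
    have := card_le_univ (univ.filter fun j => f j ≤ z (n - 1))
    simp only [Fintype.card_fin] at *
    omega
  simpa using this.symm.subset (mem_univ j)

open Classical in
theorem sum_labelWeight_isParking (w : ℕ → A) (n : ℕ) (z : ℕ → ℕ) (m : ℕ)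
    (hm : 0 < n → z (n - 1) ≤ m) :
    ∑ f ∈ Fintype.piFinset (fun _ : Fin n => Icc 1 m) with IsParking z f, labelWeight w f =
      ∑ π : Finpartition (univ : Finset (Fin n)), zetaWeight w π * (PFcount π z : A) := by
  simp only [labelWeight]
  have hswap := sum_comm' (s := {f ∈ Fintype.piFinset (fun _ : Fin n => Icc 1 m) | IsParking z f})
    (t := fun f => {π : Finpartition (univ : Finset (Fin n)) | IsConstOnParts π f})
    (t' := univ)
    (s' := fun π => {f ∈ Fintype.piFinset (fun _ : Fin n => Icc 1 m) |
      IsConstOnParts π f ∧ IsParking z f})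
    (f := fun _ π => zetaWeight w π) (by intro f π; simp; tauto)
  rw [hswap]
  refine sum_congr rfl fun π _ => ?_
  rw [sum_const, nsmul_eq_mul, mul_comm]
  congr 2
  rw [PFcount, ← Nat.card_eq_finsetCard]
  refine Nat.card_congr (Equiv.subtypeEquivRight fun f => ?_)
  refine mem_filter.trans ?_
  simp only [Fintype.mem_piFinset, mem_Icc, IsConstOnParts, and_iff_right_iff_imp]
  exact fun h a => ⟨h.2.1 a, (h.2.le a).trans (hm a.pos)⟩

section Glue

variable {a b n : ℕ} (i : Fin a ↪ Fin n) (j : Fin b ↪ Fin n)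

/-- The partition of `Fin n` glued from partitions of two complementary subsets. -/
def gluePartition (hdisj : ∀ x y, i x ≠ j y) (hcov : ∀ c, (∃ x, i x = c) ∨ ∃ y, j y = c)
    (P : Finpartition (univ : Finset (Fin a))) (Q : Finpartition (univ : Finset (Fin b))) :
    Finpartition (univ : Finset (Fin n)) :=
  Finpartition.ofExistsUnique
    (P.parts.map (mapEmbedding i).toEmbedding ∪ Q.parts.map (mapEmbedding j).toEmbedding)
    (fun _ _ => subset_univ _)
    (by
      intro c _
      rcases hcov c with ⟨x, rfl⟩ | ⟨y, rfl⟩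
      · refine ⟨(P.part x).map i, ⟨?_, ?_⟩, ?_⟩
        · simp
        · simp
        · rintro B ⟨hB, hx⟩
          simp only [mem_union, mem_map] at hB
          rcases hB with ⟨C, hC, rfl⟩ | ⟨C, hC, rfl⟩
          · simp at hx
            simp [P.part_eq_of_mem hC hx]
          · obtain ⟨y, _, hy⟩ := mem_map.1 hx
            exact (hdisj _ _ hy.symm).elim
      · refine ⟨(Q.part y).map j, ⟨?_, ?_⟩, ?_⟩
        · simp
        · simp
        · rintro B ⟨hB, hx⟩
          simp only [mem_union, mem_map] at hB
          rcases hB with ⟨C, hC, rfl⟩ | ⟨C, hC, rfl⟩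
          · obtain ⟨y, _, hy⟩ := mem_map.1 hx
            exact (hdisj _ _ hy).elim
          · simp at hx
            simp [Q.part_eq_of_mem hC hx])
    (by simp)

/-- The blocks of `π` contained in the range of `i`, seen as a partition of the domain of `i`. -/
def comapPartition (π : Finpartition (univ : Finset (Fin n)))
    (h : ∀ x, ∀ c ∈ π.part (i x), c ∈ Set.range i) : Finpartition (univ : Finset (Fin a)) :=
  Finpartition.ofExistsUnique {B | B.map i ∈ π.parts}
    (fun _ _ => subset_univ _)
    (by
      intro x _
      have hmap : (univ.filter fun y => i y ∈ π.part (i x)).map i = π.part (i x) := by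
        ext c
        simp only [mem_map, mem_filter, mem_univ, true_and]
        constructor
        · rintro ⟨y, hy, rfl⟩
          exact hy
        · intro hc
          obtain ⟨y, rfl⟩ := h x c hc
          exact ⟨y, hc, rfl⟩
      refine ⟨univ.filter fun y => i y ∈ π.part (i x), ⟨?_, ?_⟩, ?_⟩
      · simp [hmap]
      · simp
      · rintro B ⟨hB, hx⟩
        apply map_injective i
        rw [hmap]
        exact (π.part_eq_of_mem (by simpa using hB) (mem_map_of_mem i hx)).symm)
    (by simp)

variable {i j}

theorem mem_comapPartition {π : Finpartition (univ : Finset (Fin n))}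
    {h : ∀ x, ∀ c ∈ π.part (i x), c ∈ Set.range i} {C : Finset (Fin a)} :
    C ∈ (comapPartition i π h).parts ↔ C.map i ∈ π.parts := by
  simp [comapPartition, Finpartition.ofExistsUnique]

variable (hdisj : ∀ x y, i x ≠ j y) (hcov : ∀ c, (∃ x, i x = c) ∨ ∃ y, j y = c)

theorem mem_gluePartition {P : Finpartition (univ : Finset (Fin a))}
    {Q : Finpartition (univ : Finset (Fin b))} {B : Finset (Fin n)} :
    B ∈ (gluePartition i j hdisj hcov P Q).parts ↔
      (∃ C ∈ P.parts, C.map i = B) ∨ ∃ C ∈ Q.parts, C.map j = B := by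
  simp [gluePartition]

theorem map_ne_map_of_disjoint_range (hdisj : ∀ x y, i x ≠ j y) {C : Finset (Fin a)} {D : Finset (Fin b)}
    (hC : C.Nonempty) : C.map i ≠ D.map j := by
  intro h
  obtain ⟨x, hx⟩ := hC
  obtain ⟨y, _, hy⟩ := mem_map.1 (h ▸ mem_map_of_mem i hx)
  exact hdisj x y hy.symm

theorem map_mem_gluePartition_left {P : Finpartition (univ : Finset (Fin a))}
    {Q : Finpartition (univ : Finset (Fin b))} {C : Finset (Fin a)} :
    C.map i ∈ (gluePartition i j hdisj hcov P Q).parts ↔ C ∈ P.parts := by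
  rw [mem_gluePartition]
  constructor
  · rintro (⟨D, hD, h⟩ | ⟨D, hD, h⟩)
    · rwa [← map_injective i h]
    · exact (map_ne_map_of_disjoint_range (fun x y => (hdisj y x).symm) (Q.nonempty_of_mem_parts hD) h).elim
  · exact fun h => Or.inl ⟨C, h, rfl⟩

theorem map_mem_gluePartition_right {P : Finpartition (univ : Finset (Fin a))}
    {Q : Finpartition (univ : Finset (Fin b))} {C : Finset (Fin b)} :
    C.map j ∈ (gluePartition i j hdisj hcov P Q).parts ↔ C ∈ Q.parts := by
  rw [mem_gluePartition]
  constructor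
  · rintro (⟨D, hD, h⟩ | ⟨D, hD, h⟩)
    · exact (map_ne_map_of_disjoint_range hdisj (P.nonempty_of_mem_parts hD) h).elim
    · rwa [← map_injective j h]
  · exact fun h => Or.inr ⟨C, h, rfl⟩

theorem zetaWeight_gluePartition (w : ℕ → A) (P : Finpartition (univ : Finset (Fin a)))
    (Q : Finpartition (univ : Finset (Fin b))) :
    zetaWeight w (gluePartition i j hdisj hcov P Q) = zetaWeight w P * zetaWeight w Q := by
  simp only [zetaWeight, gluePartition, Finpartition.ofExistsUnique_parts]
  rw [prod_union, prod_map, prod_map]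
  · simp
  · rw [disjoint_left]
    intro B hB hB'
    obtain ⟨C, hC, rfl⟩ := mem_map.1 hB
    obtain ⟨D, hD, h⟩ := mem_map.1 hB'
    exact map_ne_map_of_disjoint_range hdisj (P.nonempty_of_mem_parts hC) h.symm

theorem isConstOnParts_gluePartition {P : Finpartition (univ : Finset (Fin a))}
    {Q : Finpartition (univ : Finset (Fin b))} {f : Fin n → ℕ} :
    IsConstOnParts (gluePartition i j hdisj hcov P Q) f ↔
      IsConstOnParts P (f ∘ i) ∧ IsConstOnParts Q (f ∘ j) := by
  simp only [IsConstOnParts, mem_gluePartition]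
  constructor
  · intro h
    exact ⟨fun B hB x hx y hy => h _ (Or.inl ⟨B, hB, rfl⟩) _ (mem_map_of_mem i hx) _
        (mem_map_of_mem i hy),
      fun B hB x hx y hy => h _ (Or.inr ⟨B, hB, rfl⟩) _ (mem_map_of_mem j hx) _
        (mem_map_of_mem j hy)⟩
  · rintro ⟨h₁, h₂⟩ _ (⟨B, hB, rfl⟩ | ⟨B, hB, rfl⟩) _ hx' _ hy'
    · obtain ⟨x, hx, rfl⟩ := mem_map.1 hx'
      obtain ⟨y, hy, rfl⟩ := mem_map.1 hy'
      exact h₁ B hB x hx y hy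
    · obtain ⟨x, hx, rfl⟩ := mem_map.1 hx'
      obtain ⟨y, hy, rfl⟩ := mem_map.1 hy'
      exact h₂ B hB x hx y hy

theorem labelWeight_eq_mul (hdisj : ∀ x y, i x ≠ j y)
    (hcov : ∀ c, (∃ x, i x = c) ∨ ∃ y, j y = c) (w : ℕ → A) {f : Fin n → ℕ} (hf : ∀ x y, f (i x) ≠ f (j y)) :
    labelWeight w f = labelWeight w (f ∘ i) * labelWeight w (f ∘ j) := by
  classical
  simp only [labelWeight]
  rw [sum_mul_sum, ← sum_product']
  symm
  refine sum_bij (fun p _ => gluePartition i j hdisj hcov p.1 p.2) ?_ ?_ ?_ ?_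
  · rintro ⟨P, Q⟩ h
    simpa [isConstOnParts_gluePartition] using h
  · rintro ⟨P, Q⟩ - ⟨P', Q'⟩ - h
    simp only at h
    ext B
    · rw [← map_mem_gluePartition_left hdisj hcov (Q := Q), h, map_mem_gluePartition_left]
    · rw [← map_mem_gluePartition_right hdisj hcov (P := P), h, map_mem_gluePartition_right]
  · intro π hπ
    have hπ : IsConstOnParts π f := by simpa using hπ
    have hval : ∀ c, ∀ d ∈ π.part c, f d = f c := fun c d hd =>
      hπ _ (π.part_mem.2 (mem_univ c)) _ hd _ (π.mem_part (mem_univ c))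
    have hi : ∀ x, ∀ c ∈ π.part (i x), c ∈ Set.range i := by
      intro x c hc
      rcases hcov c with h | ⟨y, rfl⟩
      · exact h
      · exact (hf x y (hval _ _ hc).symm).elim
    have hj : ∀ y, ∀ c ∈ π.part (j y), c ∈ Set.range j := by
      intro y c hc
      rcases hcov c with ⟨x, rfl⟩ | h
      · exact (hf x y (hval _ _ hc)).elim
      · exact h
    have hglue : gluePartition i j hdisj hcov (comapPartition i π hi) (comapPartition j π hj)
        = π := by
      ext B
      rw [mem_gluePartition]
      constructor
      · rintro (⟨C, hC, rfl⟩ | ⟨C, hC, rfl⟩)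
        · exact mem_comapPartition.1 hC
        · exact mem_comapPartition.1 hC
      · intro hB
        obtain ⟨c, hc⟩ := π.nonempty_of_mem_parts hB
        rcases hcov c with ⟨x, rfl⟩ | ⟨y, rfl⟩
        · obtain ⟨C, -, rfl⟩ : ∃ C ⊆ (univ : Finset (Fin a)), C.map i = B := by
            rw [← π.part_eq_of_mem hB hc]
            obtain ⟨C, hC, h⟩ := subset_map_iff.1 (show π.part (i x) ⊆ univ.map i from
              fun c hc => by simpa using hi x c hc)
            exact ⟨C, hC, h.symm⟩
          exact Or.inl ⟨C, mem_comapPartition.2 hB, rfl⟩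
        · obtain ⟨C, -, rfl⟩ : ∃ C ⊆ (univ : Finset (Fin b)), C.map j = B := by
            rw [← π.part_eq_of_mem hB hc]
            obtain ⟨C, hC, h⟩ := subset_map_iff.1 (show π.part (j y) ⊆ univ.map j from
              fun c hc => by simpa using hj y c hc)
            exact ⟨C, hC, h.symm⟩
          exact Or.inr ⟨C, mem_comapPartition.2 hB, rfl⟩
    refine ⟨(comapPartition i π hi, comapPartition j π hj), ?_, hglue⟩
    rw [← hglue, isConstOnParts_gluePartition] at hπ
    simpa using hπ
  · rintro ⟨P, Q⟩ -
    exact (zetaWeight_gluePartition hdisj hcov w P Q).symm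

end Glue

end LabelWeight

/-- `S` is the set of positions of the maximal initial parking part of `f`: its values form a
parking function, and all remaining values exceed `z #S`. -/
def IsCut {n : ℕ} (z : ℕ → ℕ) (f : Fin n → ℕ) (S : Finset (Fin n)) : Prop :=
  (∀ j ∉ S, z #S < f j) ∧ ∀ k < #S, k + 1 ≤ #{j ∈ S | f j ≤ z k}

theorem card_lt_of_notMem {n : ℕ} {S : Finset (Fin n)} {j : Fin n} (hj : j ∉ S) : #S < n := by
  simpa using card_lt_univ_of_notMem hj

theorem IsCut.le {n : ℕ} {z : ℕ → ℕ} {f : Fin n → ℕ} {S : Finset (Fin n)} (h : IsCut z f S)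
    {j : Fin n} (hj : j ∈ S) : f j ≤ z (#S - 1) := by
  have hS : 0 < #S := card_pos.2 ⟨j, hj⟩
  have hc := h.2 (#S - 1) (by omega)
  have := eq_of_subset_of_card_le (filter_subset (fun j => f j ≤ z (#S - 1)) S) (by omega)
  exact (mem_filter.1 (this.symm.subset hj)).2

theorem IsCut.card_le {n : ℕ} {z : ℕ → ℕ} {f : Fin n → ℕ} {S T : Finset (Fin n)}
    (hS : IsCut z f S) (hT : IsCut z f T) : #T ≤ #S := by
  by_contra! h
  have h₁ := hT.2 _ h
  have h₂ : {j ∈ T | f j ≤ z #S} ⊆ S := by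
    intro j hj
    by_contra hjS
    exact absurd (hS.1 j hjS) (not_lt.2 (mem_filter.1 hj).2)
  have := Finset.card_le_card h₂
  omega

theorem IsCut.subset {n : ℕ} {z : ℕ → ℕ} (hmono : ∀ i j, i ≤ j → j < n → z i ≤ z j)
    {f : Fin n → ℕ} {S T : Finset (Fin n)} (hS : IsCut z f S) (hT : IsCut z f T) : T ⊆ S := by
  have hcard : #S = #T := le_antisymm (hT.card_le hS) (hS.card_le hT)
  intro j hj
  by_contra hjS
  have h₁ := hS.1 j hjS
  have h₂ := hT.le hj
  have h₃ := hmono (#T - 1) #S (by omega) (card_lt_of_notMem hjS)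
  omega

theorem existsUnique_isCut {n : ℕ} {z : ℕ → ℕ} (hmono : ∀ i j, i ≤ j → j < n → z i ≤ z j)
    (f : Fin n → ℕ) : ∃! S, IsCut z f S := by
  classical
  suffices h : ∃ S, IsCut z f S by
    obtain ⟨S, hS⟩ := h
    exact ⟨S, hS, fun T hT => (hS.subset hmono hT).antisymm (hT.subset hmono hS)⟩
  have hex : ∃ i, i = n ∨ #{j | f j ≤ z i} ≤ i := ⟨n, Or.inl rfl⟩
  obtain ⟨i, hi, hmin⟩ : ∃ i, (i = n ∨ #{j | f j ≤ z i} ≤ i) ∧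
      ∀ k < i, ¬(k = n ∨ #{j | f j ≤ z k} ≤ k) :=
    ⟨Nat.find hex, Nat.find_spec hex, fun k => Nat.find_min hex⟩
  have hin : i ≤ n := by
    by_contra! h
    exact hmin n h (Or.inl rfl)
  set S : Finset (Fin n) := {j | ∃ k < i, f j ≤ z k} with hSdef
  have hsub : ∀ k < i, ({j | f j ≤ z k} : Finset (Fin n)) ⊆ S := fun k hk j hj => by
    simp only [mem_filter, mem_univ, true_and, hSdef] at hj ⊢
    exact ⟨k, hk, hj⟩
  have hle : i ≤ #S := by
    rcases i.eq_zero_or_pos with h | h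
    · omega
    · have h₁ := card_le_card (hsub (i - 1) (by omega))
      have h₂ := hmin (i - 1) (by omega)
      push Not at h₂
      omega
  have hsub' : i < n → S ⊆ ({j | f j ≤ z i} : Finset (Fin n)) := fun h j hj => by
    simp only [mem_filter, mem_univ, true_and, hSdef] at hj ⊢
    obtain ⟨k, hk, hj⟩ := hj
    exact hj.trans (hmono k i hk.le h)
  have hcard : #S = i := by
    rcases hi with rfl | hi'
    · exact le_antisymm (by simpa using card_le_univ S) hle
    · rcases hin.lt_or_eq with h | rfl
      · exact le_antisymm ((card_le_card (hsub' h)).trans hi') hle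
      · exact le_antisymm (by simpa using card_le_univ S) hle
  refine ⟨S, fun j hj => ?_, fun k hk => ?_⟩
  · have hlt := card_lt_of_notMem hj
    rw [hcard] at hlt ⊢
    have hi' := hi.resolve_left hlt.ne
    have := eq_of_subset_of_card_le (hsub' hlt) (hi'.trans hle)
    rw [this] at hj
    simpa using hj
  · rw [hcard] at hk
    have h₂ := hmin k hk
    push Not at h₂
    have : S.filter (fun j => f j ≤ z k) = univ.filter fun j => f j ≤ z k := by
      ext j
      simp only [mem_filter, mem_univ, true_and, and_iff_right_iff_imp]
      exact fun h => hsub k hk (by simpa using h)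
    rw [this]
    omega

theorem isCut_iff {n : ℕ} {z : ℕ → ℕ} {f : Fin n → ℕ} {S : Finset (Fin n)} (h1 : ∀ j, 1 ≤ f j)
    (e : Fin #S ⊕ Fin (n - #S) ≃ Fin n) (hl : ∀ a, e (.inl a) ∈ S) (hr : ∀ b, e (.inr b) ∉ S) :
    IsCut z f S ↔ (∀ b, z #S < f (e (.inr b))) ∧ IsParking z (fun a => f (e (.inl a))) := by
  have hcard : ∀ k, #{j ∈ S | f j ≤ z k} = #{a | f (e (.inl a)) ≤ z k} := fun k => by
    symm
    refine Finset.card_bij (fun a _ => e (.inl a)) ?_ ?_ ?_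
    · intro a ha
      simpa [hl] using ha
    · intro a _ b _ h
      simpa using h
    · intro j hj
      obtain ⟨x, rfl⟩ := e.surjective j
      rcases x with a | b
      · exact ⟨a, by simpa [hl] using hj, rfl⟩
      · exact (hr b (mem_filter.1 hj).1).elim
  refine and_congr ⟨fun h b => h _ (hr b), fun h j hj => ?_⟩ ?_
  · obtain ⟨x, rfl⟩ := e.surjective j
    rcases x with a | b
    · exact (hj (hl a)).elim
    · exact h b
  · simp only [hcard]
    exact ⟨fun h => ⟨fun _ => h1 _, fun i => h i i.2⟩, fun h k hk => h.2 ⟨k, hk⟩⟩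

open Classical in
theorem sum_labelWeight_isCut {A : Type*} [CommRing A] (w : ℕ → A) {n : ℕ} {z : ℕ → ℕ}
    (hmono : ∀ i j, i ≤ j → j < n → z i ≤ z j) {m : ℕ} (hm : ∀ i < n, z i ≤ m)
    (S : Finset (Fin n)) :
    ∑ f ∈ Fintype.piFinset (fun _ : Fin n => Icc 1 m) with IsCut z f S, labelWeight w f =
      aEnum w (n - #S) ((m : A) - (z #S : A)) *
        ∑ π : Finpartition (univ : Finset (Fin #S)), zetaWeight w π * (PFcount π z : A) := by
  have hSn : #S ≤ n := by simpa using card_le_univ S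
  let e : Fin #S ⊕ Fin (n - #S) ≃ Fin n := finSumEquivOfFinset rfl (by simp [card_compl])
  have hl : ∀ a, e (.inl a) ∈ S := fun a => S.orderEmbOfFin_mem rfl a
  have hr : ∀ b, e (.inr b) ∉ S := fun b =>
    mem_compl.1 (Sᶜ.orderEmbOfFin_mem (by simp [card_compl]) b)
  have hA : aEnum w (n - #S) ((m : A) - (z #S : A)) =
      ∑ h ∈ Fintype.piFinset (fun _ : Fin (n - #S) => Ioc (z #S) m), labelWeight w h := by
    rw [sum_labelWeight]
    by_cases hS : #S < n
    · rw [Nat.card_Ioc, Nat.cast_sub (hm _ hS)]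
    · simp [aEnum, show n - #S = 0 by omega]
  rw [hA, ← sum_labelWeight_isParking w #S z m fun h => hm _ (by omega), sum_mul_sum,
    ← sum_product']
  refine sum_nbij' (fun f => (fun b => f (e (.inr b)), fun a => f (e (.inl a))))
    (fun p c => Sum.elim p.2 p.1 (e.symm c)) ?_ ?_ ?_ ?_ ?_
  · intro f hf
    simp only [mem_filter, Fintype.mem_piFinset, mem_Icc, mem_product, mem_Ioc] at hf ⊢
    rw [isCut_iff (fun j => (hf.1 j).1) e hl hr] at hf
    exact ⟨fun b => ⟨hf.2.1 b, (hf.1 _).2⟩, fun a => hf.1 _, hf.2.2⟩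
  · rintro ⟨h, g⟩ hp
    simp only [mem_filter, Fintype.mem_piFinset, mem_Icc, mem_product, mem_Ioc] at hp ⊢
    have hb : ∀ c, 1 ≤ Sum.elim g h (e.symm c) ∧ Sum.elim g h (e.symm c) ≤ m := by
      intro c
      rcases e.symm c with a | b
      · exact hp.2.1 a
      · exact ⟨Nat.one_le_of_lt (hp.1 b).1, (hp.1 b).2⟩
    refine ⟨hb, ?_⟩
    rw [isCut_iff (fun j => (hb j).1) e hl hr]
    simpa using ⟨fun b => (hp.1 b).1, hp.2.2⟩
  · intro f _
    ext c
    obtain ⟨x, rfl⟩ := e.surjective c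
    rcases x with a | b <;> simp
  · rintro ⟨h, g⟩ _
    simp
  · intro f hf
    simp only [mem_filter, Fintype.mem_piFinset, mem_Icc] at hf
    rw [mul_comm]
    refine labelWeight_eq_mul (i := ⟨fun a => e (.inl a), e.injective.comp Sum.inl_injective⟩)
      (j := ⟨fun b => e (.inr b), e.injective.comp Sum.inr_injective⟩) ?_ ?_ w ?_
    · intro a b h
      simpa using e.injective h
    · intro c
      obtain ⟨x, rfl⟩ := e.surjective c
      rcases x with a | b
      · exact Or.inl ⟨a, rfl⟩
      · exact Or.inr ⟨b, rfl⟩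
    · intro a b
      have h₁ := hf.2.le (hl a)
      have h₂ := hf.2.1 _ (hr b)
      have h₃ := hmono (#S - 1) #S (by omega) (card_lt_of_notMem (hr b))
      exact ((h₁.trans h₃).trans_lt h₂).ne

/-- Lemma 3.6: for positive integers `z_0 ≤ ⋯ ≤ z_{n-1}` and an integer `x > z_{n-1}`,
`a_n(x; w) = ∑_{i=0}^{n} C(n,i) a_{n-i}(x - z_i; w) (∑_{π ∈ Π_i} w(0̂, π) PF_π(Z))`
(the inner sum being `1` for `i = 0`, as `Π_0` consists of the empty partition with
`PF = 1`). -/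
theorem aEnum_parking_decomposition (w : ℕ → R) (hw : w 1 = 1) (n : ℕ) (z : ℕ → ℕ)
    (hpos : ∀ i < n, 0 < z i) (hmono : ∀ i j, i ≤ j → j < n → z i ≤ z j)
    (x : ℤ) (hx : ∀ i < n, (z i : ℤ) < x) :
    aEnum w n (x : R)
      = ∑ i ∈ Finset.range (n + 1), (n.choose i : R) * aEnum w (n - i) ((x : R) - (z i : R)) *
          ∑ π : Finpartition (univ : Finset (Fin i)), zetaWeight w π * (PFcount π z : R) := by
  classical
  obtain ⟨m, hxm, hm⟩ : ∃ m : ℕ, aEnum w n (x : R) = aEnum w n (m : R) ∧ (0 < n → x = m) := by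
    rcases n.eq_zero_or_pos with rfl | hn
    · exact ⟨0, by simp [aEnum], by simp⟩
    · have hx0 := hx 0 hn
      refine ⟨x.toNat, ?_, fun _ => by omega⟩
      rw [← Int.cast_natCast, Int.toNat_of_nonneg (by omega)]
  have hzm : ∀ i < n, z i ≤ m := fun i hi => by
    have h₁ := hx i hi
    have h₂ := hm (by omega)
    omega
  have hxz : ∀ i, aEnum w (n - i) ((x : R) - (z i : R)) = aEnum w (n - i) ((m : R) - (z i : R)) := by
    intro i
    rcases n.eq_zero_or_pos with rfl | hn
    · simp [aEnum]
    · rw [hm hn, Int.cast_natCast]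
  have key := sum_powerset_apply_card (x := (univ : Finset (Fin n)))
    fun k => aEnum w (n - k) ((m : R) - (z k : R)) *
      ∑ π : Finpartition (univ : Finset (Fin k)), zetaWeight w π * (PFcount π z : R)
  simp only [powerset_univ, card_univ, Fintype.card_fin, nsmul_eq_mul, ← mul_assoc] at key
  simp only [hxz]
  rw [hxm, ← key]
  simp only [← sum_labelWeight_isCut w hmono hzm, sum_filter]
  rw [sum_comm]
  have hcard := sum_labelWeight w n (Icc 1 m)
  rw [Nat.card_Icc, Nat.add_sub_cancel] at hcard
  rw [← hcard]
  refine sum_congr rfl fun f _ => ?_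
  obtain ⟨S, hS, huniq⟩ := existsUnique_isCut hmono f
  rw [sum_eq_single S (fun T _ hT => if_neg fun h => hT (huniq T h)) (by simp), if_pos hS]
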